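/- Let K be a commutative semiring, t ≥ 1, and let R be a fence on r₁, …, r_t (for each 1 ≤ i < t one chosen generating relation, either r_i ≺ r_{i+1} or r_{i+1} ≺ r_i). Let m ≥ 2, h ≥ 2, take fresh elements σ₁, …, σ_m and η₁, …, η_h, and fix weights u_i = w(r_i), s_i = w(σ_i), v_j = w(η_j) in K. Define: P on {r₁, …, r_t} ∪ {σ₁, …, σ_m} ∪ {η₁, …, η_h} with the fence relations of R, the chains σ₁ ≺ ⋯ ≺ σ_m and η₁ ≺ ⋯ ≺ η_h, and σ₁ ≺ r₁, r₁ ≺ σ_m, η₁ ≺ r_t, r_t ≺ η_h; and L on two disjoint copies R′ = {r′₁, …, r′_t} and R″ = {r″₁, …, r″_t} of the fence R together with the σ's and η's, with the fence relations on each copy, the chains σ₁ ≺ ⋯ ≺ σ_m and η₁ ≺ ⋯ ≺ η_h, and σ₁ ≺ r′₁, r′_t ≺ η_h, η₁ ≺ r″_t, r″₁ ≺ σ_m, where both copies of r_i carry the weight u_i. Then Z(P) · Z(R) = Z(L) + (∏_{i=1}^{t} u_i)(∏_{i=1}^{m} s_i)(∏_{j=1}^{h} v_j) + ∏_{i=1}^{t}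 u_i. -/

import Mathlib

/-!
The combinatorial content of the second part of Proposition 4.4 of the paper, in the
down-set formalism: for a doubly-notched arc `γ₁^{(p,q)}` and a plain arc `γ₂` with the
same underlying arc (crossing the fence `R`, with spokes `σ₁, …, σ_m` at `p` and
`η₁, …, η_h` at `q`), one has
`Z(P) · Z(R) = Z(L) + (∏ u_i)(∏ s_i)(∏ v_j) + ∏ u_i`,
where `L` is the poset of the closed curve `ℓ₁` (built from two disjoint copies of the
fence `R`).
-/

attribute [local instance] Classical.propDecidable

noncomputable section

/-- The ideal sum of a configuration: the sum, over all down-sets `S` of the ground set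
(`S ⊆ ground`, closed under the generating relations: `rel x y` with `x ∈ ground` and
`y ∈ S` implies `x ∈ S`), of the product of the weights of the elements of `S`. -/
def idealSum {α K : Type*} [CommSemiring K]
    (ground : Finset α) (rel : α → α → Prop) (w : α → K) : K :=
  ∑ S ∈ ground.powerset.filter
      (fun S => ∀ x ∈ ground, ∀ y ∈ S, rel x y → x ∈ S),
    ∏ x ∈ S, w x

/-- The generating chain `f lo ≺ f (lo+1) ≺ ⋯ ≺ f hi`. -/
def chainRel {α : Type*} (f : ℕ → α) (lo hi : ℕ) : α → α → Prop :=
  fun p q => ∃ i, lo ≤ i ∧ i + 1 ≤ hi ∧ p = f i ∧ q = f (i + 1)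

/-- The single generating relation `u ≺ v`. -/
def covRel {α : Type*} (u v : α) : α → α → Prop := fun p q => p = u ∧ q = v

/-- A fence on `f 1, …, f t`: for each `1 ≤ i < t` one chosen generating relation,
either `f i ≺ f (i+1)` (when `ε i = true`) or `f (i+1) ≺ f i` (when `ε i = false`). -/
def fenceRel {α : Type*} (f : ℕ → α) (t : ℕ) (ε : ℕ → Bool) : α → α → Prop :=
  fun p q => ∃ i, 1 ≤ i ∧ i + 1 ≤ t ∧
    ((ε i = true ∧ p = f i ∧ q = f (i + 1)) ∨
     (ε i = false ∧ p = f (i + 1) ∧ q = f i))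

/-- The elements `f lo, …, f hi`. -/
def natGround {α : Type*} (f : ℕ → α) (lo hi : ℕ) : Finset α := (Finset.Icc lo hi).image f

/-- First copy `R′` of the fence (also used as the single copy of `R` in `P` and in `R`
itself). -/
def er1 : ℕ → (ℕ ⊕ ℕ) ⊕ (ℕ ⊕ ℕ) := fun i => Sum.inl (Sum.inl i)

/-- Second copy `R″` of the fence. -/
def er2 : ℕ → (ℕ ⊕ ℕ) ⊕ (ℕ ⊕ ℕ) := fun i => Sum.inl (Sum.inr i)

/-- The spokes `σ₁, …, σ_m` at `p`. -/
def es : ℕ → (ℕ ⊕ ℕ) ⊕ (ℕ ⊕ ℕ) := fun i => Sum.inr (Sum.inl i)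

/-- The spokes `η₁, …, η_h` at `q`. -/
def ee : ℕ → (ℕ ⊕ ℕ) ⊕ (ℕ ⊕ ℕ) := fun j => Sum.inr (Sum.inr j)

/-- `A` is closed under the relations of the fence of length `n` given by `ε`. -/
def IsFenceIdeal (n : ℕ) (ε : ℕ → Bool) (A : Finset ℕ) : Prop :=
  ∀ i, 1 ≤ i → i + 1 ≤ n →
    (ε i = true → i + 1 ∈ A → i ∈ A) ∧ (ε i = false → i ∈ A → i + 1 ∈ A)

/-- The subsets of `{1, …, n}` that are down-sets of the fence of length `n` given by `ε`. -/
def fenceIdeals (n : ℕ) (ε : ℕ → Bool) : Finset (Finset ℕ) :=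
  (Finset.Icc 1 n).powerset.filter (IsFenceIdeal n ε)

/-- The part of the ideal sum of a fence coming from the down-sets with prescribed behaviour at
the two ends of the fence. -/
def fenceEntry {K : Type*} [CommSemiring K] (u : ℕ → K) (ε : ℕ → Bool) (n : ℕ) (x y : Bool) : K :=
  ∑ A ∈ fenceIdeals n ε, if decide (1 ∈ A) = x ∧ decide (n ∈ A) = y then ∏ i ∈ A, u i else 0

section Fence

variable {K : Type*} [CommSemiring K] (u : ℕ → K) (ε : ℕ → Bool)

theorem sum_fenceIdeals (n : ℕ) (f : Bool → Bool → K) :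
    ∑ A ∈ fenceIdeals n ε, (∏ i ∈ A, u i) * f (decide (1 ∈ A)) (decide (n ∈ A)) =
      fenceEntry u ε n false false * f false false + fenceEntry u ε n false true * f false true +
        fenceEntry u ε n true false * f true false + fenceEntry u ε n true true * f true true := by
  simp only [fenceEntry, Finset.sum_mul, ← Finset.sum_add_distrib]
  refine Finset.sum_congr rfl fun A _ => ?_
  by_cases h1 : 1 ∈ A <;> by_cases h2 : n ∈ A <;> simp [h1, h2]

theorem fenceEntry_one (x y : Bool) :
    fenceEntry u ε 1 x y = if x = y then (if x then u 1 else 1) else 0 := by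
  have h : fenceIdeals 1 ε = {∅, {1}} := by
    ext A
    simp only [fenceIdeals, Finset.Icc_self, Finset.mem_filter, Finset.mem_powerset,
      Finset.subset_singleton_iff, Finset.mem_insert, Finset.mem_singleton, and_iff_left_iff_imp]
    intro _ i hi hi'
    omega
  rw [fenceEntry, h, Finset.sum_pair (by simp)]
  cases x <;> cases y <;> simp

theorem sum_fenceIdeals_succ {n : ℕ} (hn : 1 ≤ n) (g : Finset ℕ → K) :
    ∑ A ∈ fenceIdeals (n + 1) ε, g A = ∑ A ∈ fenceIdeals n ε,
      ((if ε n = false ∧ n ∈ A then 0 else g A) +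
        if ε n = true ∧ n ∉ A then 0 else g (insert (n + 1) A)) := by
  have hI : Finset.Icc 1 (n + 1) = insert (n + 1) (Finset.Icc 1 n) := by
    ext i; simp only [Finset.mem_insert, Finset.mem_Icc]; omega
  rw [fenceIdeals, fenceIdeals, Finset.sum_filter, Finset.sum_filter, hI,
    Finset.sum_powerset_insert (by simp), ← Finset.sum_add_distrib]
  refine Finset.sum_congr rfl fun A hA => ?_
  rw [Finset.mem_powerset] at hA
  have hlast : n + 1 ∉ A := fun h => by simpa using hA h
  have e1 : IsFenceIdeal (n + 1) ε A ↔ IsFenceIdeal n ε A ∧ ¬ (ε n = false ∧ n ∈ A) := by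
    constructor
    · intro h
      exact ⟨fun i hi hi' => h i hi (by omega), fun hc => hlast ((h n hn le_rfl).2 hc.1 hc.2)⟩
    · rintro ⟨h, h'⟩ i hi hi'
      rcases Nat.lt_or_ge i n with hlt | hge
      · exact h i hi hlt
      · obtain rfl : i = n := by omega
        exact ⟨fun _ hc => absurd hc hlast, fun a b => absurd ⟨a, b⟩ h'⟩
  have e2 : IsFenceIdeal (n + 1) ε (insert (n + 1) A) ↔
      IsFenceIdeal n ε A ∧ ¬ (ε n = true ∧ n ∉ A) := by
    constructor
    · intro h
      refine ⟨fun i hi hi' => ?_, fun hc => hc.2 ?_⟩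
      · have := h i hi (by omega)
        simpa [show i ≠ n by omega, show i ≠ n + 1 by omega] using this
      · simpa using (h n hn le_rfl).1 hc.1 (by simp)
    · rintro ⟨h, h'⟩ i hi hi'
      rcases Nat.lt_or_ge i n with hlt | hge
      · simpa [show i ≠ n by omega, show i ≠ n + 1 by omega] using h i hi hlt
      · obtain rfl : i = n := by omega
        refine ⟨fun a _ => ?_, fun _ _ => by simp⟩
        by_contra hc
        exact h' ⟨a, fun hm => hc (Finset.mem_insert_of_mem hm)⟩
  simp only [e1, e2]
  by_cases IsFenceIdeal n ε A <;> by_cases ε n = false ∧ n ∈ A <;>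
    by_cases ε n = true ∧ n ∉ A <;> simp [*]

theorem fenceEntry_succ_false {n : ℕ} (hn : 1 ≤ n) (x : Bool) :
    fenceEntry u ε (n + 1) x false =
      fenceEntry u ε n x false + if ε n then fenceEntry u ε n x true else 0 := by
  rw [fenceEntry, sum_fenceIdeals_succ ε hn]
  cases hε : ε n <;> simp only [fenceEntry, ← Finset.sum_add_distrib, if_true, if_false,
    Bool.false_eq_true, add_zero]
  all_goals
    refine Finset.sum_congr rfl fun A hA => ?_
    have hlast : n + 1 ∉ A := fun h => by
      simpa using Finset.mem_powerset.1 (Finset.mem_filter.1 hA).1 h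
    by_cases h2 : n ∈ A <;> simp [h2, hlast]

theorem fenceEntry_succ_true {n : ℕ} (hn : 1 ≤ n) (x : Bool) :
    fenceEntry u ε (n + 1) x true =
      u (n + 1) * (fenceEntry u ε n x true + if ε n then 0 else fenceEntry u ε n x false) := by
  rw [fenceEntry, sum_fenceIdeals_succ ε hn]
  cases hε : ε n <;> simp only [fenceEntry, ← Finset.sum_add_distrib, if_true, if_false,
    Bool.false_eq_true, add_zero, Finset.mul_sum]
  all_goals
    refine Finset.sum_congr rfl fun A hA => ?_
    have hlast : n + 1 ∉ A := fun h => by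
      simpa using Finset.mem_powerset.1 (Finset.mem_filter.1 hA).1 h
    by_cases h2 : n ∈ A <;> simp [h2, hlast, show n ≠ 0 by omega]

theorem fenceEntry_det {n : ℕ} (hn : 1 ≤ n) :
    fenceEntry u ε n false false * fenceEntry u ε n true true =
      fenceEntry u ε n false true * fenceEntry u ε n true false + ∏ i ∈ Finset.Icc 1 n, u i := by
  induction n, hn using Nat.le_induction with
  | base => simp [fenceEntry_one]
  | succ n hn ih =>
    rw [Finset.prod_Icc_succ_top (by omega)]
    simp only [fenceEntry_succ_false u ε hn, fenceEntry_succ_true u ε hn]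
    generalize fenceEntry u ε n false false = a at *
    generalize fenceEntry u ε n false true = b at *
    generalize fenceEntry u ε n true false = c at *
    generalize fenceEntry u ε n true true = d at *
    cases ε n <;> simp only [if_true, if_false, Bool.false_eq_true, add_zero]
    · calc a * (u (n + 1) * (d + c)) = u (n + 1) * (a * d) + u (n + 1) * (a * c) := by ring
        _ = _ := by rw [ih]; ring
    · calc (a + b) * (u (n + 1) * d) = u (n + 1) * (a * d) + u (n + 1) * (b * d) := by ring
        _ = _ := by rw [ih]; ring

theorem fenceEntry_chain_false {n : ℕ} (hn : 1 ≤ n) :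
    fenceEntry u (fun _ => true) n false false = 1 ∧
      fenceEntry u (fun _ => true) n false true = 0 := by
  induction n, hn using Nat.le_induction with
  | base => simp [fenceEntry_one]
  | succ n hn ih =>
    simp [fenceEntry_succ_false u _ hn, fenceEntry_succ_true u _ hn, ih.1, ih.2]

/-- The sum over the chain down-sets that contain the bottom if `p` holds, and contain
the top only if `q` holds. -/
theorem sum_chain_links {n : ℕ} (hn : 1 ≤ n) (p q : Prop) [Decidable p] [Decidable q] :
    (∑ B ∈ fenceIdeals n fun _ => true,
        if (p → 1 ∈ B) ∧ (n ∈ B → q) then ∏ i ∈ B, u i else 0) =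
      (if p then 0 else 1) + fenceEntry u (fun _ => true) n true false +
        if q then ∏ i ∈ Finset.Icc 1 n, u i else 0 := by
  have hsum := sum_fenceIdeals u (fun _ => true) n
    fun x y => if (p → x = true) ∧ (y = true → q) then 1 else 0
  have hdet := fenceEntry_det u (fun _ => true) hn
  rw [(fenceEntry_chain_false u hn).1, (fenceEntry_chain_false u hn).2, one_mul, zero_mul,
    zero_add] at hdet
  rw [(fenceEntry_chain_false u hn).1, (fenceEntry_chain_false u hn).2, hdet] at hsum
  simp only [decide_eq_true_eq, mul_ite, mul_one, mul_zero] at hsum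
  rw [hsum]
  by_cases p <;> by_cases q <;> simp [*]

end Fence

theorem sum_powerset_disjSum {α β K : Type*} [AddCommMonoid K] (G : Finset α) (H : Finset β)
    (f : Finset (α ⊕ β) → K) :
    ∑ S ∈ (G.disjSum H).powerset, f S =
      ∑ A ∈ G.powerset, ∑ B ∈ H.powerset, f (A.disjSum B) := by
  rw [← Finset.sum_product']
  refine Finset.sum_nbij' (fun S => (S.toLeft, S.toRight)) (fun p => p.1.disjSum p.2)
    ?_ ?_ ?_ ?_ ?_
  · intro S hS
    rw [Finset.mem_powerset] at hS
    simp only [Finset.mem_product, Finset.mem_powerset]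
    exact ⟨fun a ha => by simpa using hS (Finset.mem_toLeft.1 ha),
      fun b hb => by simpa using hS (Finset.mem_toRight.1 hb)⟩
  · intro p hp
    simp only [Finset.mem_product, Finset.mem_powerset] at hp
    exact Finset.mem_powerset.2 (Finset.disjSum_mono hp.1 hp.2)
  all_goals simp [Finset.toLeft_disjSum_toRight]

section Closed

variable {α : Type*} (G S : Finset α)

theorem closed_sup (r r' : α → α → Prop) :
    (∀ x ∈ G, ∀ y ∈ S, (r ⊔ r') x y → x ∈ S) ↔
      (∀ x ∈ G, ∀ y ∈ S, r x y → x ∈ S) ∧ ∀ x ∈ G, ∀ y ∈ S, r' x y → x ∈ S := by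
  simp only [Pi.sup_apply, sup_Prop_eq, or_imp, forall_and]

theorem closed_covRel {a b : α} (ha : a ∈ G) :
    (∀ x ∈ G, ∀ y ∈ S, covRel a b x y → x ∈ S) ↔ (b ∈ S → a ∈ S) :=
  ⟨fun h hb => h a ha b hb ⟨rfl, rfl⟩, by rintro h _ _ _ hb ⟨rfl, rfl⟩; exact h hb⟩

theorem closed_fenceRel {f : ℕ → α} {n : ℕ} {ε : ℕ → Bool} (A : Finset ℕ)
    (hf : ∀ i, 1 ≤ i → i ≤ n → f i ∈ G) (hA : ∀ i, f i ∈ S ↔ i ∈ A) :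
    (∀ x ∈ G, ∀ y ∈ S, fenceRel f n ε x y → x ∈ S) ↔ IsFenceIdeal n ε A := by
  simp only [IsFenceIdeal, ← hA]
  constructor
  · intro h i hi hi'
    exact ⟨fun he hS => h _ (hf i hi (by omega)) _ hS ⟨i, hi, hi', Or.inl ⟨he, rfl, rfl⟩⟩,
      fun he hS => h _ (hf (i + 1) (by omega) hi') _ hS ⟨i, hi, hi', Or.inr ⟨he, rfl, rfl⟩⟩⟩
  · rintro h _ _ _ hy ⟨i, hi, hi', ⟨he, rfl, rfl⟩ | ⟨he, rfl, rfl⟩⟩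
    · exact (h i hi hi').1 he hy
    · exact (h i hi hi').2 he hy

theorem chainRel_eq_fenceRel (f : ℕ → α) (n : ℕ) :
    chainRel f 1 n = fenceRel f n fun _ => true := by
  ext x y; simp [chainRel, fenceRel]

end Closed

theorem ite_sum_zero {ι K : Type*} [AddCommMonoid K] (p : Prop) (I : Finset ι) (f : ι → K) :
    (if p then ∑ i ∈ I, f i else 0) = ∑ i ∈ I, if p then f i else 0 := by
  split_ifs <;> simp

theorem idealSum_disjSum {K : Type*} [CommSemiring K] (G₁ G₂ G₃ G₄ : Finset ℕ)
    (rel : (ℕ ⊕ ℕ) ⊕ (ℕ ⊕ ℕ) → (ℕ ⊕ ℕ) ⊕ (ℕ ⊕ ℕ) → Prop) (u₁ u₂ s v : ℕ → K) :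
    idealSum ((G₁.disjSum G₂).disjSum (G₃.disjSum G₄)) rel
        (Sum.elim (Sum.elim u₁ u₂) (Sum.elim s v)) =
      ∑ A ∈ G₁.powerset, ∑ A' ∈ G₂.powerset, ∑ B ∈ G₃.powerset, ∑ C ∈ G₄.powerset,
        if ∀ x ∈ (G₁.disjSum G₂).disjSum (G₃.disjSum G₄),
            ∀ y ∈ (A.disjSum A').disjSum (B.disjSum C), rel x y →
              x ∈ (A.disjSum A').disjSum (B.disjSum C)
        then ((∏ i ∈ A, u₁ i) * ∏ i ∈ A', u₂ i) * ((∏ i ∈ B, s i) * ∏ i ∈ C, v i) else 0 := by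
  rw [idealSum, Finset.sum_filter, sum_powerset_disjSum, sum_powerset_disjSum]
  simp only [sum_powerset_disjSum, Finset.prod_disjSum, Sum.elim_inl, Sum.elim_inr]

section Configurations

variable {K : Type*} [CommSemiring K] {t m h : ℕ} (ε : ℕ → Bool) (u s v : ℕ → K)

theorem idealSum_fence :
    idealSum (natGround er1 1 t) (fenceRel er1 t ε) (Sum.elim (Sum.elim u u) (Sum.elim s v)) =
      ∑ A ∈ fenceIdeals t ε, ∏ i ∈ A, u i := by
  have hG : natGround er1 1 t =
      ((Finset.Icc 1 t).disjSum ∅).disjSum ((∅ : Finset ℕ).disjSum ∅) := by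
    ext ((x | x) | (x | x)) <;> simp [natGround, er1]
  rw [hG, idealSum_disjSum, fenceIdeals, Finset.sum_filter]
  refine Finset.sum_congr rfl fun A _ => ?_
  simp only [Finset.powerset_empty, Finset.sum_singleton, Finset.prod_empty, mul_one]
  refine if_congr ?_ rfl rfl
  rw [closed_fenceRel _ _ A (by simp +contextual [er1]) (by simp [er1])]

theorem idealSum_doublyNotched (ht : 1 ≤ t) (hm : 1 ≤ m) (hh : 1 ≤ h) :
    idealSum
        (natGround er1 1 t ∪ natGround es 1 m ∪ natGround ee 1 h)
        (fenceRel er1 t ε ⊔ chainRel es 1 m ⊔ chainRel ee 1 h ⊔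
          covRel (es 1) (er1 1) ⊔ covRel (er1 1) (es m) ⊔
          covRel (ee 1) (er1 t) ⊔ covRel (er1 t) (ee h))
        (Sum.elim (Sum.elim u u) (Sum.elim s v)) =
      ∑ A ∈ fenceIdeals t ε, (∏ i ∈ A, u i) *
        ((∑ B ∈ fenceIdeals m fun _ => true,
            if (1 ∈ A → 1 ∈ B) ∧ (m ∈ B → 1 ∈ A) then ∏ i ∈ B, s i else 0) *
          ∑ C ∈ fenceIdeals h fun _ => true,
            if (t ∈ A → 1 ∈ C) ∧ (h ∈ C → t ∈ A) then ∏ i ∈ C, v i else 0) := by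
  have hG : natGround er1 1 t ∪ natGround es 1 m ∪ natGround ee 1 h =
      ((Finset.Icc 1 t).disjSum ∅).disjSum ((Finset.Icc 1 m).disjSum (Finset.Icc 1 h)) := by
    ext ((x | x) | (x | x)) <;> simp [natGround, er1, es, ee]
  rw [hG, idealSum_disjSum]
  simp only [fenceIdeals, Finset.sum_filter, Finset.powerset_empty, Finset.sum_singleton,
    Finset.prod_empty, mul_one, Finset.sum_mul_sum]
  refine Finset.sum_congr rfl fun A _ => ?_
  simp only [Finset.mul_sum, ite_sum_zero]
  refine Finset.sum_congr rfl fun B _ => ?_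
  refine Finset.sum_congr rfl fun C _ => ?_
  simp only [mul_ite, ite_mul, mul_zero, zero_mul, ← ite_and]
  refine if_congr ?_ rfl rfl
  simp only [closed_sup, chainRel_eq_fenceRel]
  rw [closed_fenceRel _ _ A (by simp +contextual [er1]) (by simp [er1]),
    closed_fenceRel _ _ B (by simp +contextual [es]) (by simp [es]),
    closed_fenceRel _ _ C (by simp +contextual [ee]) (by simp [ee]),
    closed_covRel _ _ (by simpa [es]),
    closed_covRel _ _ (by simpa [er1]), closed_covRel _ _ (by simpa [ee]),
    closed_covRel _ _ (by simpa [er1])]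
  simp only [er1, es, ee, Finset.inl_mem_disjSum, Finset.inr_mem_disjSum]
  constructor
  · rintro ⟨⟨⟨⟨⟨⟨a, b⟩, c⟩, d⟩, e⟩, f⟩, g⟩
    exact ⟨a, ⟨c, f, g⟩, b, d, e⟩
  · rintro ⟨a, ⟨c, f, g⟩, b, d, e⟩
    exact ⟨⟨⟨⟨⟨⟨a, b⟩, c⟩, d⟩, e⟩, f⟩, g⟩

theorem idealSum_closedCurve (ht : 1 ≤ t) (hm : 1 ≤ m) (hh : 1 ≤ h) :
    idealSum
        (natGround er1 1 t ∪ natGround er2 1 t ∪ natGround es 1 m ∪ natGround ee 1 h)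
        (fenceRel er1 t ε ⊔ fenceRel er2 t ε ⊔ chainRel es 1 m ⊔ chainRel ee 1 h ⊔
          covRel (es 1) (er1 1) ⊔ covRel (er1 t) (ee h) ⊔
          covRel (ee 1) (er2 t) ⊔ covRel (er2 1) (es m))
        (Sum.elim (Sum.elim u u) (Sum.elim s v)) =
      ∑ A ∈ fenceIdeals t ε, (∏ i ∈ A, u i) * ∑ A' ∈ fenceIdeals t ε, (∏ i ∈ A', u i) *
        ((∑ B ∈ fenceIdeals m fun _ => true,
            if (1 ∈ A → 1 ∈ B) ∧ (m ∈ B → 1 ∈ A') then ∏ i ∈ B, s i else 0) *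
          ∑ C ∈ fenceIdeals h fun _ => true,
            if (t ∈ A' → 1 ∈ C) ∧ (h ∈ C → t ∈ A) then ∏ i ∈ C, v i else 0) := by
  have hG : natGround er1 1 t ∪ natGround er2 1 t ∪ natGround es 1 m ∪ natGround ee 1 h =
      ((Finset.Icc 1 t).disjSum (Finset.Icc 1 t)).disjSum
        ((Finset.Icc 1 m).disjSum (Finset.Icc 1 h)) := by
    ext ((x | x) | (x | x)) <;> simp [natGround, er1, er2, es, ee]
  rw [hG, idealSum_disjSum]
  simp only [fenceIdeals, Finset.sum_filter, Finset.sum_mul_sum]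
  refine Finset.sum_congr rfl fun A _ => ?_
  simp only [Finset.mul_sum, ite_sum_zero, mul_ite, mul_zero]
  refine Finset.sum_congr rfl fun A' _ => ?_
  refine Finset.sum_congr rfl fun B _ => ?_
  refine Finset.sum_congr rfl fun C _ => ?_
  simp only [mul_ite, ite_mul, mul_zero, zero_mul, ← ite_and, mul_assoc]
  refine if_congr ?_ rfl rfl
  simp only [closed_sup, chainRel_eq_fenceRel]
  rw [closed_fenceRel _ _ A (by simp +contextual [er1]) (by simp [er1]),
    closed_fenceRel _ _ A' (by simp +contextual [er2]) (by simp [er2]),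
    closed_fenceRel _ _ B (by simp +contextual [es]) (by simp [es]),
    closed_fenceRel _ _ C (by simp +contextual [ee]) (by simp [ee]),
    closed_covRel _ _ (by simpa [es]),
    closed_covRel _ _ (by simpa [er1]), closed_covRel _ _ (by simpa [ee]),
    closed_covRel _ _ (by simpa [er2])]
  simp only [er1, er2, es, ee, Finset.inl_mem_disjSum, Finset.inr_mem_disjSum]
  constructor
  · rintro ⟨⟨⟨⟨⟨⟨⟨a, a'⟩, b⟩, c⟩, d⟩, e⟩, f⟩, g⟩
    exact ⟨a, a', c, ⟨f, e⟩, b, d, g⟩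
  · rintro ⟨a, a', c, ⟨f, e⟩, b, d, g⟩
    exact ⟨⟨⟨⟨⟨⟨⟨a, a'⟩, b⟩, c⟩, d⟩, e⟩, f⟩, g⟩

end Configurations

theorem skein_doubly_notched_plain_same_underlying_arc
    (K : Type*) [CommSemiring K]
    (t : ℕ) (ht : 1 ≤ t) (ε : ℕ → Bool)
    (m h : ℕ) (hm : 2 ≤ m) (hh : 2 ≤ h)
    (u s v : ℕ → K) :
    -- Z(P) · Z(R)
    idealSum
        (natGround er1 1 t ∪ natGround es 1 m ∪ natGround ee 1 h)
        (fenceRel er1 t ε ⊔ chainRel es 1 m ⊔ chainRel ee 1 h ⊔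
          covRel (es 1) (er1 1) ⊔ covRel (er1 1) (es m) ⊔
          covRel (ee 1) (er1 t) ⊔ covRel (er1 t) (ee h))
        (Sum.elim (Sum.elim u u) (Sum.elim s v)) *
      idealSum (natGround er1 1 t) (fenceRel er1 t ε)
        (Sum.elim (Sum.elim u u) (Sum.elim s v))
    -- = Z(L) + (∏u)(∏s)(∏v) + ∏u
    = idealSum
        (natGround er1 1 t ∪ natGround er2 1 t ∪ natGround es 1 m ∪ natGround ee 1 h)
        (fenceRel er1 t ε ⊔ fenceRel er2 t ε ⊔ chainRel es 1 m ⊔ chainRel ee 1 h ⊔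
          covRel (es 1) (er1 1) ⊔ covRel (er1 t) (ee h) ⊔
          covRel (ee 1) (er2 t) ⊔ covRel (er2 1) (es m))
        (Sum.elim (Sum.elim u u) (Sum.elim s v))
      + (∏ i ∈ Finset.Icc 1 t, u i) * (∏ i ∈ Finset.Icc 1 m, s i) *
          (∏ j ∈ Finset.Icc 1 h, v j)
      + ∏ i ∈ Finset.Icc 1 t, u i := by
  have hm' : 1 ≤ m := by omega
  have hh' : 1 ≤ h := by omega
  rw [idealSum_doublyNotched ε u s v ht hm' hh', idealSum_fence,
    idealSum_closedCurve ε u s v ht hm' hh']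
  simp only [sum_chain_links _ hm', sum_chain_links _ hh']
  generalize fenceEntry s (fun _ => true) m true false = X
  generalize fenceEntry v (fun _ => true) h true false = Y
  generalize ∏ i ∈ Finset.Icc 1 m, s i = S
  generalize ∏ j ∈ Finset.Icc 1 h, v j = V
  have hP := sum_fenceIdeals u ε t fun x y =>
    ((if x = true then 0 else 1) + X + if x = true then S else 0) *
      ((if y = true then 0 else 1) + Y + if y = true then V else 0)
  have hR := sum_fenceIdeals u ε t fun _ _ => 1
  have hL' := fun x y : Bool => sum_fenceIdeals u ε t fun x' y' =>
    ((if x = true then 0 else 1) + X + if x' = true then S else 0) *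
      ((if y' = true then 0 else 1) + Y + if y = true then V else 0)
  have hL := sum_fenceIdeals u ε t fun x y => ∑ A' ∈ fenceIdeals t ε, (∏ i ∈ A', u i) *
    (((if x = true then 0 else 1) + X + if decide (1 ∈ A') = true then S else 0) *
      ((if decide (t ∈ A') = true then 0 else 1) + Y + if y = true then V else 0))
  have h00 := hL' false false
  have h01 := hL' false true
  have h10 := hL' true false
  have h11 := hL' true true
  simp only [decide_eq_true_eq, Bool.false_eq_true, if_true, if_false, mul_one, zero_add,
    add_zero] at hP hR hL h00 h01 h10 h11
  rw [hP, hR, hL, h00, h01, h10, h11]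
  have hdet := fenceEntry_det u ε ht
  generalize ∏ i ∈ Finset.Icc 1 t, u i = U at *
  generalize fenceEntry u ε t false false = a at *
  generalize fenceEntry u ε t false true = b at *
  generalize fenceEntry u ε t true false = c at *
  generalize fenceEntry u ε t true true = d at *
  calc
    _ = a * (a + b + c) + S * V * d * (b + c + d) +
          (S * c + V * b + X * (a + c) + X * V * (b + d) + X * Y * (a + b + c + d) + Y * (a + b) +
            Y * S * (c + d)) * (a + b + c + d) + (a * d) * (1 + S * V) := by ring
    _ = _ := by rw [hdet]; ring
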